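/- Let X ⊆ FIN_{A⋆} be an infinite block sequence and let f : [X]_A → C be a coloring into a finite set C. Then there exist a finite set F ⊆ [X]_{A⋆} and an infinite block sequence Y ⊆ [X − F]_{A⋆} such that F full-matches Y. -/

import Mathlib

namespace Carlson

/-- The domain of a partial function `ℕ →. B`, encoded as `ℕ → Option B`. -/
def dom {B : Type*} (p : ℕ → Option B) : Set ℕ := {n | p n ≠ none}

/-- `p` is a located word over `B`: a partial function with finite nonempty domain. -/
def IsLW {B : Type*} (p : ℕ → Option B) : Prop := (dom p).Finite ∧ (dom p).Nonempty

/-- A located variable word over `A` is a located word over `Option A`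
(where `none` encodes the variable `⋆`) taking the value `⋆` at least once. -/
def IsLVW {A : Type*} (p : ℕ → Option (Option A)) : Prop :=
  IsLW p ∧ ∃ n, p n = some none

/-- `p < q`: every element of the domain of `p` is below every element of the domain of `q`. -/
def blt {B : Type*} (p q : ℕ → Option B) : Prop :=
  ∀ m ∈ dom p, ∀ n ∈ dom q, m < n

/-- Union `p ∪ q` of two partial functions (`p` takes precedence; for `blt p q`
the domains are disjoint, so this is the genuine union). -/
def pun {B : Type*} (p q : ℕ → Option B) : ℕ → Option B :=
  fun n => (p n).elim (q n) some

/-- The empty partial function. -/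
def emptyW {B : Type*} : ℕ → Option B := fun _ => none

/-- `p[a]`: substitution of the letter `a ∈ A` for the variable `⋆` in a located
variable word. -/
def substA {A : Type*} (p : ℕ → Option (Option A)) (a : A) : ℕ → Option A :=
  fun n => (p n).map fun x => x.getD a

/-- `p[a]` for `a ∈ A ∪ {⋆}` (with `none` encoding `⋆`, so `p[⋆] = p`). -/
def substV {A : Type*} (p : ℕ → Option (Option A)) (a : Option A) : ℕ → Option (Option A) :=
  fun n => (p n).map fun x => x.elim a some

/-- Union of a finite family of partial functions with pairwise disjoint domains. -/
def famUnion {B : Type*} {k : ℕ} (g : Fin k → ℕ → Option B) : ℕ → Option B :=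
  fun n => ((List.ofFn fun i => g i n).filterMap id).head?

/-- A block sequence: a set of located variable words totally ordered by `<`. -/
def IsBlockSeq {A : Type*} (X : Set (ℕ → Option (Option A))) : Prop :=
  (∀ p ∈ X, IsLVW p) ∧ ∀ p ∈ X, ∀ q ∈ X, p = q ∨ blt p q ∨ blt q p

/-- `[X]_A`: located words of the form `p₀[a₀] ∪ ⋯ ∪ p_k[a_k]` with `p₀ < ⋯ < p_k`
all in `X` and `a₀, …, a_k ∈ A`. -/
def combA {A : Type*} (X : Set (ℕ → Option (Option A))) : Set (ℕ → Option A) :=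
  { q | ∃ (k : ℕ) (p : Fin (k + 1) → ℕ → Option (Option A)) (a : Fin (k + 1) → A),
      (∀ i, p i ∈ X) ∧ (∀ i j : Fin (k + 1), i < j → blt (p i) (p j)) ∧
      q = famUnion fun i => substA (p i) (a i) }

/-- `[X]_{A⋆}`: located variable words of the form `p₀[a₀] ∪ ⋯ ∪ p_k[a_k]` with
`p₀ < ⋯ < p_k` all in `X`, `a₀, …, a_k ∈ A ∪ {⋆}`, and `⋆` used at least once. -/
def combV {A : Type*} (X : Set (ℕ → Option (Option A))) : Set (ℕ → Option (Option A)) :=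
  { q | ∃ (k : ℕ) (p : Fin (k + 1) → ℕ → Option (Option A)) (a : Fin (k + 1) → Option A),
      (∀ i, p i ∈ X) ∧ (∀ i j : Fin (k + 1), i < j → blt (p i) (p j)) ∧
      (∃ i, a i = none) ∧ q = famUnion fun i => substV (p i) (a i) }

/-- `X − F`: the elements of `X` whose domain lies entirely above the domains of
all members of `F`. -/
def sminus {B : Type*} (X F : Set (ℕ → Option B)) : Set (ℕ → Option B) :=
  { q ∈ X | ∀ p ∈ F, blt p q }

/-- `dom q ⊆ [0, ℓ)`. -/
def domBelow {B : Type*} (q : ℕ → Option B) (ℓ : ℕ) : Prop := ∀ n ∈ dom q, n < ℓ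

/-- `dom q ⊆ [m, ∞)`. -/
def domAbove {B : Type*} (q : ℕ → Option B) (m : ℕ) : Prop := ∀ n ∈ dom q, m ≤ n

/-- `S^ℓ_p(f) = S^ℓ_{p'}(g)` for colorings of located words: agreement at `q ∪ p`
vs `q ∪ p'` for every located word `q` with domain contained in `[0, ℓ)`.
(Take `p' = emptyW` to express `S^ℓ_p(f) = S^ℓ(g)`.) -/
def SEq {A C : Type*} (f g : (ℕ → Option A) → C) (ℓ : ℕ) (p p' : ℕ → Option A) : Prop :=
  ∀ q : ℕ → Option A, IsLW q → domBelow q ℓ → f (pun q p) = g (pun q p')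

/-- Variant of `SEq` for colorings that are also defined at the empty located word,
i.e. `q` ranges over `FIN_A(0, ℓ) ∪ {∅}`. -/
def SEq0 {A C : Type*} (f g : (ℕ → Option A) → C) (ℓ : ℕ) (p p' : ℕ → Option A) : Prop :=
  ∀ q : ℕ → Option A, (dom q).Finite → domBelow q ℓ → f (pun q p) = g (pun q p')

/-- A coloring `f` is recurrent if for every `ℓ` there is a located variable word `p`
with domain in `[ℓ, ∞)` such that `S^ℓ_{p[a]}(f) = S^ℓ(f)` for every `a ∈ A`. -/
def Recurrent {A C : Type*} (f : (ℕ → Option A) → C) : Prop :=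
  ∀ ℓ : ℕ, ∃ p : ℕ → Option (Option A), IsLVW p ∧ domAbove p ℓ ∧
    ∀ a : A, SEq f f ℓ (substA p a) emptyW

/-- A coloring `f` is uniformly recurrent if for every `ℓ` there is `m > ℓ` such that
for every `p ∈ FIN_A(m, ∞)` there is `q ∈ FIN_A(ℓ, m)` with `S^ℓ_{q ∪ p}(f) = S^ℓ(f)`. -/
def UnifRecurrent {A C : Type*} (f : (ℕ → Option A) → C) : Prop :=
  ∀ ℓ : ℕ, ∃ m : ℕ, ℓ < m ∧ ∀ p : ℕ → Option A, IsLW p → domAbove p m →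
    ∃ q : ℕ → Option A, IsLW q ∧ domAbove q ℓ ∧ domBelow q m ∧
      SEq f f ℓ (pun q p) emptyW

/-- `f` and `g` are weakly proximal: for every `ℓ` there is `p ∈ FIN_A(ℓ, ∞)` with
`S^ℓ_p(f) = S^ℓ_p(g)`. -/
def WeakProx {A C : Type*} (f g : (ℕ → Option A) → C) : Prop :=
  ∀ ℓ : ℕ, ∃ p : ℕ → Option A, IsLW p ∧ domAbove p ℓ ∧ SEq f g ℓ p p

/-- `g` is strongly proximal to `f`: for every `ℓ` there is a located variable word `p`
with domain in `[ℓ, ∞)` such that `S^ℓ(g) = S^ℓ_{p[a]}(g) = S^ℓ_{p[a]}(f)` for all `a ∈ A`. -/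
def StrongProx {A C : Type*} (g f : (ℕ → Option A) → C) : Prop :=
  ∀ ℓ : ℕ, ∃ p : ℕ → Option (Option A), IsLVW p ∧ domAbove p ℓ ∧
    ∀ a : A, SEq g g ℓ emptyW (substA p a) ∧ SEq g f ℓ (substA p a) (substA p a)

/-- `Recurrent` for colorings also defined at the empty located word. -/
def Recurrent0 {A C : Type*} (f : (ℕ → Option A) → C) : Prop :=
  ∀ ℓ : ℕ, ∃ p : ℕ → Option (Option A), IsLVW p ∧ domAbove p ℓ ∧
    ∀ a : A, SEq0 f f ℓ (substA p a) emptyW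

/-- `StrongProx` for colorings also defined at the empty located word. -/
def StrongProx0 {A C : Type*} (g f : (ℕ → Option A) → C) : Prop :=
  ∀ ℓ : ℕ, ∃ p : ℕ → Option (Option A), IsLVW p ∧ domAbove p ℓ ∧
    ∀ a : A, SEq0 g g ℓ emptyW (substA p a) ∧ SEq0 g f ℓ (substA p a) (substA p a)

/-- Agreement of two colorings on all located words with domain in `[0, ℓ)`. -/
def AgreeBelow {A C : Type*} (f g : (ℕ → Option A) → C) (ℓ : ℕ) : Prop :=
  ∀ q : ℕ → Option A, IsLW q → domBelow q ℓ → f q = g q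

/-- Closedness of a class in `C^{FIN_A}` with the product topology (`C` discrete):
a class is closed iff it contains every coloring all of whose finite restrictions
(to located words with domain in `[0, ℓ)`, for each `ℓ`) are matched within the class. -/
def IsClosedColl {A C : Type*} (𝓒 : Set ((ℕ → Option A) → C)) : Prop :=
  ∀ f, (∀ ℓ : ℕ, ∃ g ∈ 𝓒, AgreeBelow f g ℓ) → f ∈ 𝓒

/-- A subshift: a nonempty closed class `𝓒 ⊆ C^{FIN_A}` such that for every `f ∈ 𝓒`,
`ℓ ∈ ℕ` and `p ∈ FIN_A(ℓ, ∞)` there is `g ∈ 𝓒` with `S^ℓ(g) = S^ℓ_p(f)`. -/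
def IsSubshift {A C : Type*} (𝓒 : Set ((ℕ → Option A) → C)) : Prop :=
  𝓒.Nonempty ∧ IsClosedColl 𝓒 ∧
    ∀ f ∈ 𝓒, ∀ ℓ : ℕ, ∀ p : ℕ → Option A, IsLW p → domAbove p ℓ →
      ∃ g ∈ 𝓒, SEq g f ℓ emptyW p

/-- A minimal subshift: no subshift is a proper subset of it. -/
def IsMinimalSubshift {A C : Type*} (𝓒 : Set ((ℕ → Option A) → C)) : Prop :=
  IsSubshift 𝓒 ∧ ∀ 𝓓 : Set ((ℕ → Option A) → C), IsSubshift 𝓓 → 𝓓 ⊆ 𝓒 → 𝓓 = 𝓒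

/-- The orbit closure of a coloring `f`: all `g` such that for every `ℓ` and every
`q ∈ FIN_A(ℓ, ∞)` there is `p ∈ FIN_A(ℓ, ∞)` with `S^ℓ_q(g) = S^ℓ_p(f)`. -/
def orbCl {A C : Type*} (f : (ℕ → Option A) → C) : Set ((ℕ → Option A) → C) :=
  { g | ∀ ℓ : ℕ, ∀ q : ℕ → Option A, IsLW q → domAbove q ℓ →
      ∃ p : ℕ → Option A, IsLW p ∧ domAbove p ℓ ∧ SEq g f ℓ q p }

/-- A variable word over `A`, encoded as a list over `Option A` with `none` = `⋆`:
the variable must occur at least once. -/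
def IsVarWord {A : Type*} (w : List (Option A)) : Prop := none ∈ w

/-- `w[a]`: replace every occurrence of the variable `⋆` by the letter `a`. -/
def substW {A : Type*} (w : List (Option A)) (a : A) : List A :=
  w.map fun x => x.getD a

/-- `⟨(w_n)_{n∈ℕ}⟩_A`: the words `w_{j₀}[a₀] ⋯ w_{j_{k-1}}[a_{k-1}]` extracted from
the sequence `(w_n)`, for `j₀ < ⋯ < j_{k-1}` and letters `a₀, …, a_{k-1} ∈ A`. -/
def extracted {A : Type*} (w : ℕ → List (Option A)) : Set (List A) :=
  { u | ∃ (k : ℕ) (j : Fin (k + 1) → ℕ) (a : Fin (k + 1) → A),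
      StrictMono j ∧ u = (List.ofFn fun i => substW (w (j i)) (a i)).flatten }

section CompactSemigroup

variable {M : Type*} [Semigroup M] [TopologicalSpace M] [T2Space M]

/-- A compact right topological semigroup has a minimal closed left ideal. -/
theorem exists_minimal_closed_left_ideal (hc : ∀ r : M, Continuous (· * r)) (S : Set M)
    (hne : S.Nonempty) (hS : IsCompact S) (hmul : ∀ᵉ (x ∈ S) (y ∈ S), x * y ∈ S) :
    ∃ I ⊆ S, IsCompact I ∧ I.Nonempty ∧ (∀ s ∈ S, ∀ x ∈ I, s * x ∈ I) ∧
      ∀ e ∈ I, ∀ y ∈ I, ∃ x ∈ S, x * e = y := by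
  let 𝓘 : Set (Set M) := {I | IsCompact I ∧ I.Nonempty ∧ I ⊆ S ∧ ∀ s ∈ S, ∀ x ∈ I, s * x ∈ I}
  obtain ⟨I, -, hI⟩ : ∃ I, I ⊆ S ∧ Minimal (· ∈ 𝓘) I := by
    refine zorn_superset_nonempty 𝓘 (fun c hcs hchain hcne => ?_) S ⟨hS, hne, subset_rfl, hmul⟩
    have hclosed : ∀ t ∈ c, IsClosed t := fun t ht => (hcs ht).1.isClosed
    obtain ⟨t₀, ht₀⟩ := hcne
    refine ⟨⋂₀ c, ⟨(hcs ht₀).1.of_isClosed_subset (isClosed_sInter hclosed)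
      (Set.sInter_subset_of_mem ht₀), ?_, (Set.sInter_subset_of_mem ht₀).trans (hcs ht₀).2.2.1, ?_⟩,
      fun t ht => Set.sInter_subset_of_mem ht⟩
    · have : Nonempty c := ⟨⟨t₀, ht₀⟩⟩
      exact IsCompact.nonempty_sInter_of_directed_nonempty_isCompact_isClosed
        (IsChain.directedOn hchain.symm) (fun t ht => (hcs ht).2.1) (fun t ht => (hcs ht).1)
        hclosed
    · exact fun s hs x hx t ht => (hcs ht).2.2.2 s hs x (hx t ht)
  obtain ⟨hIc, hIne, hIS, hIl⟩ := hI.prop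
  refine ⟨I, hIS, hIc, hIne, hIl, fun e he y hy => ?_⟩
  have key : (· * e) '' S = I := by
    refine hI.eq_of_subset ⟨hS.image (hc e), hne.image _, ?_, ?_⟩ ?_
    · rintro _ ⟨x, hx, rfl⟩
      exact hmul _ hx _ (hIS he)
    · rintro s hs _ ⟨x, hx, rfl⟩
      exact ⟨s * x, hmul _ hs _ hx, mul_assoc _ _ _⟩
    · rintro _ ⟨x, hx, rfl⟩
      exact hIl _ hx _ he
  rw [← key] at hy
  exact hy

/-- A compact right topological semigroup has an idempotent that is minimal for the order
`e ≤ w ↔ e * w = e ∧ w * e = e`. -/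
theorem exists_minimal_idempotent (hc : ∀ r : M, Continuous (· * r)) (S : Set M)
    (hne : S.Nonempty) (hS : IsCompact S) (hmul : ∀ᵉ (x ∈ S) (y ∈ S), x * y ∈ S) :
    ∃ w ∈ S, w * w = w ∧ ∀ e ∈ S, e * e = e → e * w = e → w * e = e → e = w := by
  obtain ⟨I, hIS, hIc, hIne, hIl, hI⟩ := exists_minimal_closed_left_ideal hc S hne hS hmul
  obtain ⟨w, hw, hww⟩ := exists_idempotent_in_compact_subsemigroup hc I hIne hIc
    fun x hx y hy => hIl x (hIS hx) y hy
  refine ⟨w, hIS hw, hww, fun e he hee hew hwe => ?_⟩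
  obtain ⟨x, -, hx⟩ := hI e (hew ▸ hIl e he w hw) w hw
  calc e = x * (e * e) := by rw [hee, hx, ← hwe, ← hx, mul_assoc, hee]
    _ = w := by rw [hee, hx]

/-- Below an idempotent `w` normalizing a compact semigroup `V` there is an idempotent of `V`. -/
theorem exists_idempotent_below (hc : ∀ r : M, Continuous (· * r)) (V : Set M)
    (hne : V.Nonempty) (hV : IsCompact V) (hmul : ∀ᵉ (x ∈ V) (y ∈ V), x * y ∈ V)
    {w : M} (hw : w * w = w) (hl : ∀ x ∈ V, w * x ∈ V) (hr : ∀ x ∈ V, x * w ∈ V) :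
    ∃ v ∈ V, v * v = v ∧ v * w = v ∧ w * v = v := by
  obtain ⟨_, ⟨x, hx, rfl⟩, he⟩ := exists_idempotent_in_compact_subsemigroup hc ((· * w) '' V)
    (hne.image _) (hV.image (hc w)) (by
      rintro _ ⟨x, hx, rfl⟩ _ ⟨y, hy, rfl⟩
      exact ⟨x * w * y, hmul _ (hr _ hx) _ hy, mul_assoc _ _ _⟩)
  replace he : x * w * (x * w) = x * w := he
  refine ⟨w * (x * w), hl _ (hr _ hx), ?_, ?_, ?_⟩
  · calc w * (x * w) * (w * (x * w)) = w * (x * (w * w) * (x * w)) := by simp only [mul_assoc]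
      _ = w * (x * w) := by rw [hw, he]
  · rw [mul_assoc, mul_assoc, hw]
  · rw [← mul_assoc, hw]

end CompactSemigroup

section Words

variable {A B : Type*}

theorem pun_assoc (p q r : ℕ → Option B) : pun (pun p q) r = pun p (pun q r) := by
  funext n
  simp only [pun]
  cases p n <;> rfl

instance : Semigroup (ℕ → Option B) where
  mul := pun
  mul_assoc := pun_assoc

theorem mul_eq_pun (p q : ℕ → Option B) : p * q = pun p q := rfl

theorem mem_dom_pun {p q : ℕ → Option B} {n : ℕ} : n ∈ dom (pun p q) ↔ n ∈ dom p ∨ n ∈ dom q := by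
  simp only [dom, pun, Set.mem_ofPred_eq]
  cases p n <;> simp

theorem pun_emptyW (p : ℕ → Option B) : pun p emptyW = p := by
  funext n
  simp only [pun, emptyW]
  cases p n <;> rfl

theorem famUnion_zero (g : Fin 0 → ℕ → Option B) : famUnion g = emptyW := rfl

theorem famUnion_succ {k : ℕ} (g : Fin (k + 1) → ℕ → Option B) :
    famUnion g = pun (g 0) (famUnion fun i => g i.succ) := by
  funext n
  simp only [famUnion, pun, List.ofFn_succ, List.filterMap_cons, id]
  cases g 0 n <;> simp

theorem famUnion_append {k l : ℕ} (g : Fin k → ℕ → Option B) (h : Fin l → ℕ → Option B) :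
    famUnion (Fin.append g h) = pun (famUnion g) (famUnion h) := by
  funext n
  have : (fun i => Fin.append g h i n) = Fin.append (fun i => g i n) (fun i => h i n) := by
    funext i
    refine Fin.addCases (fun j => ?_) (fun j => ?_) i <;> simp
  simp only [famUnion, pun, this, List.ofFn_fin_append, List.filterMap_append, List.head?_append]
  cases (List.filterMap id (List.ofFn fun i => g i n)).head? <;> rfl

theorem mem_dom_famUnion {k : ℕ} {g : Fin k → ℕ → Option B} {n : ℕ} :
    n ∈ dom (famUnion g) ↔ ∃ i, n ∈ dom (g i) := by
  induction k with
  | zero => simp [famUnion_zero, dom, emptyW]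
  | succ k ih => rw [famUnion_succ, mem_dom_pun, ih, Fin.exists_fin_succ]

theorem famUnion_eq_some {k : ℕ} {g : Fin k → ℕ → Option B} {n : ℕ} {x : B}
    (hg : ∀ i j, i < j → blt (g i) (g j)) {i : Fin k} (hi : g i n = some x) :
    famUnion g n = some x := by
  induction k with
  | zero => exact i.elim0
  | succ k ih =>
    rw [famUnion_succ, pun]
    induction i using Fin.cases with
    | zero => rw [hi]; rfl
    | succ i =>
      have h0 : g 0 n = none := by
        by_contra h
        exact lt_irrefl n (hg 0 i.succ i.succ_pos n h n (by simp [dom, hi]))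
      rw [h0]
      exact ih (fun i j hij => hg _ _ (Fin.succ_lt_succ_iff.2 hij)) hi

theorem dom_substV (p : ℕ → Option (Option A)) (a : Option A) : dom (substV p a) = dom p := by
  ext n
  simp [dom, substV]

theorem dom_substA (p : ℕ → Option (Option A)) (a : A) : dom (substA p a) = dom p := by
  ext n
  simp [dom, substA]

/-- A located word viewed as a word over `A ∪ {⋆}`. -/
def emb (p : ℕ → Option A) : ℕ → Option (Option A) := fun n => (p n).map some

theorem dom_emb (p : ℕ → Option A) : dom (emb p) = dom p := by
  ext n
  simp [dom, emb]

theorem emb_mul (p q : ℕ → Option A) : emb (p * q) = emb p * emb q := by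
  funext n
  simp only [mul_eq_pun, emb, pun]
  cases p n <;> rfl

theorem substA_mul (a : A) (p q : ℕ → Option (Option A)) :
    substA (p * q) a = substA p a * substA q a := by
  funext n
  simp only [mul_eq_pun, substA, pun]
  cases p n <;> rfl

theorem substA_emb (a : A) (p : ℕ → Option A) : substA (emb p) a = p := by
  funext n
  simp only [substA, emb]
  cases p n <;> rfl

theorem emb_substA (p : ℕ → Option (Option A)) (a : A) :
    emb (substA p a) = substV p (some a) := by
  funext n
  simp only [substA, emb, substV]
  rcases p n with _ | _ | _ <;> rfl

theorem substV_substV (p : ℕ → Option (Option A)) (a b : Option A) :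
    substV (substV p a) b = substV p (a.elim b some) := by
  funext n
  simp only [substV]
  rcases p n with _ | _ | _ <;> rfl

theorem substV_pun (p q : ℕ → Option (Option A)) (a : Option A) :
    substV (pun p q) a = pun (substV p a) (substV q a) := by
  funext n
  simp only [substV, pun]
  cases p n <;> rfl

theorem substV_famUnion {k : ℕ} (g : Fin k → ℕ → Option (Option A)) (a : Option A) :
    substV (famUnion g) a = famUnion fun i => substV (g i) a := by
  induction k with
  | zero => rfl
  | succ k ih => rw [famUnion_succ, substV_pun, ih, ← famUnion_succ fun i => substV (g i) a]

/-- The words `p₀[a₀] ∪ ⋯ ∪ p_k[a_k]` with `p₀ < ⋯ < p_k` in `X` and `aᵢ ∈ A ∪ {⋆}`, where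
`⋆` has to be used if `s` holds. -/
def comb (X : Set (ℕ → Option (Option A))) (s : Prop) : Set (ℕ → Option (Option A)) :=
  { q | ∃ (k : ℕ) (p : Fin (k + 1) → ℕ → Option (Option A)) (a : Fin (k + 1) → Option A),
      (∀ i, p i ∈ X) ∧ (∀ i j : Fin (k + 1), i < j → blt (p i) (p j)) ∧
      (s → ∃ i, a i = none) ∧ q = famUnion fun i => substV (p i) (a i) }

variable {X : Set (ℕ → Option (Option A))}

theorem comb_true : comb X True = combV X := by
  simp only [comb, combV, true_imp_iff]

theorem pun_mem_comb {s t u : Prop} (hu : u → s ∨ t) {q r : ℕ → Option (Option A)}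
    (hq : q ∈ comb X s) (hr : r ∈ comb X t) (hqr : blt q r) : pun q r ∈ comb X u := by
  obtain ⟨k, p, a, hp, hpp, ha, rfl⟩ := hq
  obtain ⟨l, p', a', hp', hpp', ha', rfl⟩ := hr
  have hcross : ∀ i j, blt (p i) (p' j) := fun i j m hm n hn =>
    hqr m (mem_dom_famUnion.2 ⟨i, by rwa [dom_substV]⟩) n
      (mem_dom_famUnion.2 ⟨j, by rwa [dom_substV]⟩)
  refine ⟨k + 1 + l, Fin.append (m := k + 1) (n := l + 1) p p',
    Fin.append (m := k + 1) (n := l + 1) a a', fun i => ?_, fun i j => ?_, fun h => ?_, ?_⟩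
  · refine Fin.addCases (m := k + 1) (n := l + 1) (fun i => ?_) (fun i => ?_) i
    · simpa using hp i
    · simpa using hp' i
  · refine Fin.addCases (m := k + 1) (n := l + 1) (fun i => ?_) (fun i => ?_) i <;>
      refine Fin.addCases (m := k + 1) (n := l + 1) (fun j => ?_) (fun j => ?_) j
    · intro hij
      simpa using hpp i j hij
    · intro _
      simpa using hcross i j
    · intro hij
      have := j.isLt
      simp only [Fin.lt_def, Fin.val_natAdd, Fin.val_castAdd] at hij
      omega
    · intro hij
      simpa using hpp' i j (by simpa only [Fin.lt_def, Fin.val_natAdd, add_lt_add_iff_left] using hij)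
  · rcases hu h with h | h
    · obtain ⟨i, hi⟩ := ha h
      exact ⟨Fin.castAdd (l + 1) i, (Fin.append_left a a' i).trans hi⟩
    · obtain ⟨i, hi⟩ := ha' h
      exact ⟨Fin.natAdd (k + 1) i, (Fin.append_right a a' i).trans hi⟩
  · rw [← famUnion_append]
    congr 1
    funext i
    refine Fin.addCases (m := k + 1) (n := l + 1) (fun i => ?_) (fun i => ?_) i <;> simp

theorem substV_mem_comb {s t : Prop} {q : ℕ → Option (Option A)} (hq : q ∈ comb X s)
    (ht : ¬t) (b : Option A) : substV q b ∈ comb X t := by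
  obtain ⟨k, p, a, hp, hpp, -, rfl⟩ := hq
  refine ⟨k, p, fun i => (a i).elim b some, hp, hpp, fun h => absurd h ht, ?_⟩
  simp only [substV_famUnion, substV_substV]

theorem finite_dom_of_mem_comb (hX : IsBlockSeq X) {s : Prop} {q : ℕ → Option (Option A)}
    (hq : q ∈ comb X s) : (dom q).Finite := by
  obtain ⟨k, p, a, hp, -, -, rfl⟩ := hq
  refine (Set.finite_iUnion fun i => (hX.1 _ (hp i)).1.1).subset fun n hn => ?_
  obtain ⟨i, hi⟩ := mem_dom_famUnion.1 hn
  exact Set.mem_iUnion.2 ⟨i, by rwa [dom_substV] at hi⟩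

theorem isLVW_of_mem_combV (hX : IsBlockSeq X) {q : ℕ → Option (Option A)}
    (hq : q ∈ combV X) : IsLVW q := by
  have hfin : (dom q).Finite := finite_dom_of_mem_comb hX (comb_true.symm ▸ hq)
  obtain ⟨k, p, a, hp, hpp, ⟨i, hi⟩, rfl⟩ := hq
  obtain ⟨n, hn⟩ := (hX.1 _ (hp i)).2
  have hstar : famUnion (fun i => substV (p i) (a i)) n = some none := by
    refine famUnion_eq_some (i := i) (fun i j hij => ?_) (by simp [substV, hn, hi])
    simpa only [blt, dom_substV] using hpp i j hij
  exact ⟨⟨hfin, n, by simp [dom, hstar]⟩, n, hstar⟩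

theorem mem_combV_sminus {F : Set (ℕ → Option (Option A))} {q : ℕ → Option (Option A)}
    (hq : q ∈ combV X) (hF : ∀ p ∈ F, blt p q) : q ∈ combV (sminus X F) := by
  obtain ⟨k, p, a, hp, hpp, ha, rfl⟩ := hq
  refine ⟨k, p, a, fun i => ⟨hp i, fun r hr m hm n hn => ?_⟩, hpp, ha, rfl⟩
  exact hF r hr m hm n (mem_dom_famUnion.2 ⟨i, by rwa [dom_substV]⟩)

theorem mem_combV_of_mem {p : ℕ → Option (Option A)} (hp : p ∈ X) : p ∈ combV X := by
  refine ⟨0, fun _ => p, fun _ => none, fun _ => hp, fun i j hij => ?_, ⟨0, rfl⟩, ?_⟩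
  · omega
  · rw [famUnion_succ, famUnion_zero, pun_emptyW]
    funext n
    simp only [substV]
    rcases p n with _ | _ | _ <;> rfl

theorem exists_domAbove (hX : IsBlockSeq X) (hXinf : X.Infinite) (n : ℕ) :
    ∃ p ∈ X, domAbove p n := by
  by_contra! h
  have h' : ∀ p ∈ X, ∃ m ∈ dom p, m < n := fun p hp => by simpa [domAbove] using h p hp
  choose! m hm hmn using h'
  refine hXinf (Set.Finite.of_finite_image ((Set.finite_lt_nat n).subset
    (Set.image_subset_iff.2 hmn)) fun p hp q hq hpq => ?_)
  rcases hX.2 p hp q hq with h | h | h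
  · exact h
  · exact absurd hpq (h _ (hm p hp) _ (hm q hq)).ne
  · exact absurd hpq (h _ (hm q hq) _ (hm p hp)).ne'

end Words

section Ultrafilters

attribute [local instance] Ultrafilter.semigroup

theorem map_mul_ultrafilter {M N : Type*} [Semigroup M] [Semigroup N] {φ : M → N}
    (hφ : ∀ x y, φ (x * y) = φ x * φ y) (U V : Ultrafilter M) :
    (U * V).map φ = U.map φ * V.map φ := by
  refine Ultrafilter.coe_inj.mp <| Filter.ext' fun p => ?_
  simp only [Ultrafilter.coe_map, Filter.eventually_map, Ultrafilter.eventually_mul, hφ]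

variable {A B B' : Type*}

/-- The ultrafilters concentrated on the words of `K` with domain in `[n, ∞)`, for each `n`. -/
def cofinal (K : Set (ℕ → Option B)) : Set (Ultrafilter (ℕ → Option B)) :=
  {U | ∀ n, K ∩ {q | domAbove q n} ∈ U}

theorem isCompact_cofinal (K : Set (ℕ → Option B)) : IsCompact (cofinal K) := by
  have : cofinal K = ⋂ n, {U | K ∩ {q | domAbove q n} ∈ U} := by
    ext U
    simp [cofinal]
  rw [this]
  exact (isClosed_iInter fun n => ultrafilter_isClosed_basic _).isCompact

theorem cofinal_nonempty {K : Set (ℕ → Option B)} (hK : ∀ n, ∃ q ∈ K, domAbove q n) :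
    (cofinal K).Nonempty := by
  have hne : (⨅ n, Filter.principal (K ∩ {q | domAbove q n})).NeBot := by
    refine Filter.iInf_neBot_of_directed' (fun m n => ⟨max m n, ?_, ?_⟩) fun n => ?_
    · exact Filter.principal_mono.2 fun q hq =>
        ⟨hq.1, fun i hi => (le_max_left m n).trans (hq.2 i hi)⟩
    · exact Filter.principal_mono.2 fun q hq =>
        ⟨hq.1, fun i hi => (le_max_right m n).trans (hq.2 i hi)⟩
    · exact Filter.principal_neBot_iff.2 (hK n)
  refine ⟨Ultrafilter.of (⨅ n, Filter.principal (K ∩ {q | domAbove q n})), fun n => ?_⟩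
  exact Ultrafilter.of_le _ (Filter.mem_iInf_of_mem n (Filter.mem_principal_self _))

theorem mul_mem_cofinal {K K' K'' : Set (ℕ → Option B)} (hfin : ∀ p ∈ K, (dom p).Finite)
    (hmul : ∀ p ∈ K, ∀ q ∈ K', blt p q → pun p q ∈ K'') {U V : Ultrafilter (ℕ → Option B)}
    (hU : U ∈ cofinal K) (hV : V ∈ cofinal K') : U * V ∈ cofinal K'' := by
  intro n
  refine (Ultrafilter.eventually_mul U V (· ∈ K'' ∩ {q | domAbove q n})).2 ?_
  filter_upwards [hU n] with p hp
  obtain ⟨m, hm⟩ := (hfin p hp.1).bddAbove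
  filter_upwards [hV (max n (m + 1))] with q hq
  refine ⟨hmul p hp.1 q hq.1 fun i hi j hj => ?_, fun i hi => ?_⟩
  · have := hm hi
    have := hq.2 j hj
    omega
  · rcases mem_dom_pun.1 hi with hi | hi
    · exact hp.2 i hi
    · exact (le_max_left _ _).trans (hq.2 i hi)

theorem map_mem_cofinal {K : Set (ℕ → Option B)} {K' : Set (ℕ → Option B')}
    {φ : (ℕ → Option B) → ℕ → Option B'} (hφ : ∀ p ∈ K, φ p ∈ K') (hdom : ∀ p, dom (φ p) = dom p)
    {U : Ultrafilter (ℕ → Option B)} (hU : U ∈ cofinal K) : U.map φ ∈ cofinal K' := by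
  intro n
  refine Ultrafilter.mem_map.2 ?_
  filter_upwards [hU n] with p hp
  exact ⟨hφ p hp.1, by simpa only [domAbove, Set.mem_ofPred_eq, hdom] using hp.2⟩

/-- There are an idempotent ultrafilter `w` of located words and an ultrafilter `v` of located
variable words all of whose substitution instances are `w`. -/
theorem exists_idempotent_substA_eq [Nonempty A] {X : Set (ℕ → Option (Option A))}
    (hX : IsBlockSeq X) (hXinf : X.Infinite) :
    ∃ w : Ultrafilter (ℕ → Option A), ∃ v ∈ cofinal (combV X),
      w * w = w ∧ ∀ a : A, v.map (fun p => substA p a) = w := by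
  have hne : (cofinal (combV X)).Nonempty := cofinal_nonempty fun n =>
    (exists_domAbove hX hXinf n).imp fun p hp => ⟨mem_combV_of_mem hp.1, hp.2⟩
  rw [← comb_true] at hne ⊢
  let K : Set (ℕ → Option A) := {p | emb p ∈ comb X False}
  have hfin : ∀ s, ∀ p ∈ comb X s, (dom p).Finite := fun s p hp => finite_dom_of_mem_comb hX hp
  have hθ : ∀ s, ∀ a : A, ∀ p ∈ comb X s, substA p a ∈ K := fun s a p hp => by
    simpa only [K, Set.mem_ofPred_eq, emb_substA] using substV_mem_comb hp not_false (some a)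
  obtain ⟨w, hwK, hww, hmin⟩ := exists_minimal_idempotent Ultrafilter.continuous_mul_left
    (cofinal K)
    (hne.elim fun _ hv =>
      ⟨_, map_mem_cofinal (hθ True (Classical.arbitrary A)) (fun p => dom_substA p _) hv⟩)
    (isCompact_cofinal K)
    (fun U hU V hV => mul_mem_cofinal (fun p hp => dom_emb p ▸ hfin _ _ hp)
      (fun p hp q hq hpq => by
        have := pun_mem_comb (u := False) False.elim hp hq (by simpa only [blt, dom_emb] using hpq)
        rwa [← mul_eq_pun, ← emb_mul] at this) hU hV)
  have hw' : w.map emb ∈ cofinal (comb X False) := 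
    map_mem_cofinal (φ := emb) (fun p hp => hp) dom_emb hwK
  obtain ⟨v, hv, hvv, hvw, hwv⟩ := exists_idempotent_below Ultrafilter.continuous_mul_left
    (cofinal (comb X True)) hne (isCompact_cofinal _)
    (fun U hU V hV => mul_mem_cofinal (hfin _) (fun p hp q hq => pun_mem_comb Or.inl hp hq) hU hV)
    (w := w.map emb) (by rw [← map_mul_ultrafilter emb_mul, hww])
    (fun V hV => mul_mem_cofinal (hfin _) (fun p hp q hq => pun_mem_comb Or.inr hp hq) hw' hV)
    (fun U hU => mul_mem_cofinal (hfin _) (fun p hp q hq => pun_mem_comb Or.inl hp hq) hU hw')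
  refine ⟨w, v, hv, hww, fun a => ?_⟩
  have hwa : (w.map emb).map (fun p => substA p a) = w := by
    rw [Ultrafilter.map_map]
    convert w.map_id using 2
    funext p
    exact substA_emb a p
  refine hmin _ (map_mem_cofinal (hθ True a) (fun p => dom_substA p a) hv) ?_ ?_ ?_
  · rw [← map_mul_ultrafilter (substA_mul a), hvv]
  · conv_lhs => rw [← hwa]
    rw [← map_mul_ultrafilter (substA_mul a), hvw]
  · conv_lhs => rw [← hwa]
    rw [← map_mul_ultrafilter (substA_mul a), hwv]

theorem exists_substA_mem [Finite A] {K : Set (ℕ → Option (Option A))}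
    {w : Ultrafilter (ℕ → Option A)} {v : Ultrafilter (ℕ → Option (Option A))}
    (hw : w * w = w) (hv : v ∈ cofinal K) (hvw : ∀ a : A, v.map (fun p => substA p a) = w)
    {D : Set (ℕ → Option A)} (hD : D ∈ w) (n : ℕ) :
    ∃ p ∈ K, domAbove p n ∧ (∀ a, substA p a ∈ D) ∧ ∀ a, {q | pun (substA p a) q ∈ D} ∈ w := by
  have hD' : ∀ᶠ x in w, x ∈ D ∧ {q | pun x q ∈ D} ∈ w := by
    refine Filter.Eventually.and hD ?_
    rw [← hw] at hD
    exact (Ultrafilter.eventually_mul w w (· ∈ D)).1 hD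
  have h : ∀ᶠ p in v, ∀ a, substA p a ∈ D ∧ {q | pun (substA p a) q ∈ D} ∈ w := by
    refine Filter.eventually_all.2 fun a => ?_
    rw [← hvw a, Ultrafilter.coe_map, Filter.eventually_map] at hD'
    simpa only [hvw a] using hD'
  obtain ⟨p, hp, hpK⟩ := (h.and (hv n)).exists
  exact ⟨p, hpK.1, hpK.2, fun a => (hp a).1, fun a => (hp a).2⟩

end Ultrafilters

section Carlson

variable {A : Type*}

theorem famUnion_substA_mem {y : ℕ → ℕ → Option (Option A)} {D : ℕ → Set (ℕ → Option A)}
    (hD : Antitone D) (hy : ∀ n a, substA (y n) a ∈ D n)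
    (hmul : ∀ n a, ∀ q ∈ D (n + 1), pun (substA (y n) a) q ∈ D n)
    {k : ℕ} {m : Fin (k + 1) → ℕ} (hm : StrictMono m) (a : Fin (k + 1) → A) :
    famUnion (fun i => substA (y (m i)) (a i)) ∈ D (m 0) := by
  induction k with
  | zero =>
    rw [famUnion_succ, famUnion_zero, pun_emptyW]
    exact hy _ _
  | succ k ih =>
    rw [famUnion_succ]
    refine hmul _ _ _ (hD (hm (Fin.succ_pos 0)) ?_)
    exact ih (hm.comp (Fin.strictMono_succ)) fun i => a i.succ

/-- **Carlson's theorem** for located words: some infinite block sequence generates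
a monochromatic set of located words. -/
theorem exists_monochromatic {C : Type*} [Finite A] [Nonempty A] [Finite C]
    {X : Set (ℕ → Option (Option A))} (hX : IsBlockSeq X) (hXinf : X.Infinite)
    (f : (ℕ → Option A) → C) :
    ∃ (c : C) (y : ℕ → ℕ → Option (Option A)), (∀ n, y n ∈ combV X) ∧
      (∀ m n, m < n → blt (y m) (y n)) ∧
      ∀ (k : ℕ) (m : Fin (k + 1) → ℕ), StrictMono m → ∀ a : Fin (k + 1) → A,
        f (famUnion fun i => substA (y (m i)) (a i)) = c := by
  obtain ⟨w, v, hv, hww, hvw⟩ := exists_idempotent_substA_eq hX hXinf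
  obtain ⟨c, hc⟩ : ∃ c, ∀ᶠ q in w, f q = c :=
    Ultrafilter.eventually_exists_iff.1 (Filter.Eventually.of_forall fun q => ⟨f q, rfl⟩)
  have step : ∀ s : {D // D ∈ w} × ℕ, ∃ p ∈ combV X, domAbove p s.2 ∧
      (∀ a, substA p a ∈ s.1.1) ∧ ∀ a, {q | pun (substA p a) q ∈ s.1.1} ∈ w := fun s =>
    exists_substA_mem hww hv hvw s.1.2 s.2
  choose p hpX hpn hpD hpw using step
  have hbound : ∀ s, ∃ m, s.2 ≤ m ∧ domBelow (p s) m := fun s => by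
    obtain ⟨m, hm⟩ := (isLVW_of_mem_combV hX (hpX s)).1.1.bddAbove
    exact ⟨max s.2 (m + 1), le_max_left _ _, fun n hn =>
      (Nat.lt_succ_of_le (hm hn)).trans_le (le_max_right _ _)⟩
  choose b hb hpb using hbound
  let next : {D // D ∈ w} × ℕ → {D // D ∈ w} × ℕ := fun s =>
    (⟨s.1.1 ∩ ⋂ a, {q | pun (substA (p s) a) q ∈ s.1.1},
      Filter.inter_mem s.1.2 (Filter.iInter_mem.2 (hpw s))⟩, b s)
  let st : ℕ → {D // D ∈ w} × ℕ := fun n => next^[n] (⟨{q | f q = c}, hc⟩, 0)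
  have hst : ∀ n, st (n + 1) = next (st n) := fun n => Function.iterate_succ_apply' _ _ _
  have hmono : Monotone fun n => (st n).2 :=
    monotone_nat_of_le_succ fun n => by rw [hst]; exact hb _
  have hanti : Antitone fun n => (st n).1.1 :=
    antitone_nat_of_succ_le fun n => by rw [hst]; exact Set.inter_subset_left
  refine ⟨c, fun n => p (st n), fun n => hpX _, fun m n hmn i hi j hj => ?_,
    fun k m hm a => ?_⟩
  · have h1 : i < (st (m + 1)).2 := by rw [hst]; exact hpb _ i hi
    exact (h1.trans_le (hmono hmn)).trans_le (hpn _ j hj)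
  · have := famUnion_substA_mem hanti (fun n => hpD (st n)) (fun n a q hq => by
      rw [hst] at hq
      exact Set.mem_iInter.1 hq.2 a) hm a
    exact hanti (Nat.zero_le _) this

end Carlson

/-- For every infinite block sequence `X` and coloring `f : [X]_A → C`, there are a
finite `F ⊆ [X]_{A⋆}` and an infinite block sequence `Y ⊆ [X − F]_{A⋆}` such that `F`
full-matches `Y`. -/
theorem full_match {A C : Type*} [Fintype A] [Nonempty A] [Fintype C]
    (X : Set (ℕ → Option (Option A))) (hX : IsBlockSeq X) (hXinf : X.Infinite)
    (f : (ℕ → Option A) → C) :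
    ∃ F : Set (ℕ → Option (Option A)), F.Finite ∧ F ⊆ combV X ∧
      ∃ Y : Set (ℕ → Option (Option A)), Y ⊆ combV (sminus X F) ∧
        IsBlockSeq Y ∧ Y.Infinite ∧
        ∀ q ∈ combA Y, ∃ p ∈ F, ∀ a : A,
          f (substA p a) = f q ∧ f (pun (substA p a) q) = f q := by
  obtain ⟨c, y, hyX, hy, hf⟩ := exists_monochromatic hX hXinf f
  have hlvw : ∀ n, IsLVW (y n) := fun n => isLVW_of_mem_combV hX (hyX n)
  have hlt : ∀ m n, blt (y m) (y n) → m < n := fun m n h => by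
    by_contra! hnm
    obtain ⟨i, hi⟩ := (hlvw m).1.2
    obtain ⟨j, hj⟩ := (hlvw n).1.2
    have hij := h i hi j hj
    rcases hnm.eq_or_lt with rfl | hnm
    · exact lt_irrefl i (h i hi i hi)
    · exact lt_asymm hij (hy n m hnm j hj i hi)
  refine ⟨{y 0}, Set.finite_singleton _, Set.singleton_subset_iff.2 (hyX 0),
    Set.range fun n => y (n + 1), ?_, ⟨?_, ?_⟩, ?_, ?_⟩
  · rintro _ ⟨n, rfl⟩
    refine mem_combV_sminus (hyX _) ?_
    rintro _ rfl
    exact hy _ _ n.succ_pos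
  · rintro _ ⟨n, rfl⟩
    exact hlvw _
  · rintro _ ⟨m, rfl⟩ _ ⟨n, rfl⟩
    rcases lt_trichotomy m n with h | rfl | h
    · exact Or.inr (Or.inl (hy _ _ (Nat.succ_lt_succ h)))
    · exact Or.inl rfl
    · exact Or.inr (Or.inr (hy _ _ (Nat.succ_lt_succ h)))
  · refine Set.infinite_range_of_injective fun m n hmn => ?_
    replace hmn : y (m + 1) = y (n + 1) := hmn
    rcases lt_trichotomy m n with h | h | h
    · exact absurd (hlt _ _ (hmn ▸ hy _ _ (Nat.succ_lt_succ h))) (lt_irrefl _)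
    · exact h
    · exact absurd (hlt _ _ (hmn ▸ hy _ _ (Nat.succ_lt_succ h))) (lt_irrefl _)
  · rintro q ⟨k, p, a, hp, hpp, rfl⟩
    choose m hm using hp
    obtain rfl : (fun i => y (m i + 1)) = p := funext hm
    have hmono : StrictMono fun i => m i + 1 := fun i j hij => hlt _ _ (hpp i j hij)
    refine ⟨y 0, rfl, fun b => ?_⟩
    rw [hf k _ hmono a]
    constructor
    · have := hf 0 (fun _ => 0) (fun i j hij => absurd hij (by omega)) (fun _ => b)
      rwa [famUnion_succ, famUnion_zero, pun_emptyW] at this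
    · have := hf (k + 1) (Fin.cons 0 fun i => m i + 1)
        (Fin.strictMono_cons.2 ⟨fun i => (m i).succ_pos, hmono⟩) (Fin.cons b a)
      rwa [famUnion_succ] at this

end Carlson
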